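/- Let ν be a real number with 0 < ν ≤ 1/3. Then the derivative of C satisfies C′(α) = 8α(α² + 2)(α² + 3ν − 1)(α² − 3ν − 1), and for every real number α with C′(α) = 0 one has C(α) < 0. -/

import Mathlib

/-- The octic polynomial `C(α) = α^8 − 6(3ν²+1)α^4 + 8(1−9ν²)α² − 3(9ν⁴+6ν²+1)`,
regarded as a function of a complex variable. -/
noncomputable def Cfun (ν : ℝ) (α : ℂ) : ℂ :=
  α ^ 8 - 6 * (3 * (ν : ℂ) ^ 2 + 1) * α ^ 4 + 8 * (1 - 9 * (ν : ℂ) ^ 2) * α ^ 2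
    - 3 * (9 * (ν : ℂ) ^ 4 + 6 * (ν : ℂ) ^ 2 + 1)

theorem deriv_Cfun (ν : ℝ) (α : ℂ) : deriv (Cfun ν) α =
    8 * α * (α ^ 2 + 2) * (α ^ 2 + 3 * (ν : ℂ) - 1) * (α ^ 2 - 3 * (ν : ℂ) - 1) := by
  have h := ((((hasDerivAt_pow 8 α).sub
    ((hasDerivAt_pow 4 α).const_mul (6 * (3 * (ν : ℂ) ^ 2 + 1)))).add
    ((hasDerivAt_pow 2 α).const_mul (8 * (1 - 9 * (ν : ℂ) ^ 2)))).sub_const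
    (3 * (9 * (ν : ℂ) ^ 4 + 6 * (ν : ℂ) ^ 2 + 1)))
  have h' : HasDerivAt (Cfun ν) _ α := h
  rw [h'.deriv]
  push_cast
  ring

theorem Cfun_ofReal (ν a : ℝ) : Cfun ν (a : ℂ) =
    ((a ^ 8 - 6 * (3 * ν ^ 2 + 1) * a ^ 4 + 8 * (1 - 9 * ν ^ 2) * a ^ 2
      - 3 * (9 * ν ^ 4 + 6 * ν ^ 2 + 1) : ℝ) : ℂ) := by
  simp [Cfun]

/-- The value of the octic at a critical point with `a ^ 2 = 1 + 3 * t`, where `t = ±ν`. -/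
theorem octic_eq_of_sq_eq {t a : ℝ} (h : a ^ 2 = 1 + 3 * t) :
    a ^ 8 - 6 * (3 * t ^ 2 + 1) * a ^ 4 + 8 * (1 - 9 * t ^ 2) * a ^ 2
      - 3 * (9 * t ^ 4 + 6 * t ^ 2 + 1) = -108 * (t * (1 + t)) ^ 2 := by
  rw [show a ^ 8 = (a ^ 2) ^ 4 by ring, show a ^ 4 = (a ^ 2) ^ 2 by ring, h]
  ring

/-- For `0 < ν ≤ 1/3`: the derivative of `C` is
`C′(α) = 8α(α²+2)(α²+3ν−1)(α²−3ν−1)`, and at every real critical point of `C` the value of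
`C` is a negative real number. -/
theorem stmt_1 (ν : ℝ) (hν0 : 0 < ν) (hν1 : ν ≤ 1 / 3) :
    (∀ α : ℂ, deriv (Cfun ν) α =
      8 * α * (α ^ 2 + 2) * (α ^ 2 + 3 * (ν : ℂ) - 1) * (α ^ 2 - 3 * (ν : ℂ) - 1)) ∧
    (∀ a : ℝ, deriv (Cfun ν) (a : ℂ) = 0 →
      (Cfun ν (a : ℂ)).re < 0 ∧ (Cfun ν (a : ℂ)).im = 0) := by
  refine ⟨deriv_Cfun ν, fun a ha => ?_⟩
  rw [deriv_Cfun] at ha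
  rw [Cfun_ofReal, Complex.ofReal_re, Complex.ofReal_im]
  refine ⟨?_, rfl⟩
  have hr : 8 * a * (a ^ 2 + 2) * (a ^ 2 + 3 * ν - 1) * (a ^ 2 - 3 * ν - 1) = 0 := by
    exact_mod_cast ha
  have h2 : a ^ 2 + 2 ≠ 0 := by positivity
  simp only [mul_eq_zero, h2, or_false, OfNat.ofNat_ne_zero, false_or] at hr
  rcases hr with (rfl | h) | h
  · have : 0 < 9 * ν ^ 4 + 6 * ν ^ 2 + 1 := by positivity
    linarith
  · have key := octic_eq_of_sq_eq (t := -ν) (a := a) (by linarith)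
    have hne : -ν * (1 + -ν) ≠ 0 := mul_ne_zero (by linarith) (by linarith)
    have : 0 < (-ν * (1 + -ν)) ^ 2 := by positivity
    rw [Even.neg_pow (by decide), Even.neg_pow (by decide)] at key
    linarith
  · have key := octic_eq_of_sq_eq (t := ν) (a := a) (by linarith)
    have : 0 < (ν * (1 + ν)) ^ 2 := by positivity
    linarith
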